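/- Let Σ be a finite alphabet and let f : Σ* → ℝ be a function such that the linear span, inside the space of real-valued functions on Σ*, of the family {v ↦ f(uv) : u ∈ Σ*} of rows of its Hankel matrix has finite dimension k. Then there exists a weighted finite automaton with exactly k states, i.e. vectors α, ω ∈ ℝ^k and matrices A_σ ∈ ℝ^{k×k} for σ ∈ Σ, such that f(x₁x₂⋯xₙ) = αᵀ A_{x₁} A_{x₂} ⋯ A_{xₙ} ω for every word x₁⋯xₙ ∈ Σ*. -/

import Mathlib

open Matrix

/-- If the span of the rows of the Hankel matrix of `f : Σ* → ℝ` (the functions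
`v ↦ f (u ++ v)` for `u ∈ Σ*`) is finite-dimensional of dimension `k`, then `f` is
computed by a weighted finite automaton with exactly `k` states. -/
theorem exists_wfa_of_hankel_row_span_finrank
    {Γ : Type} [Fintype Γ] (f : List Γ → ℝ) (k : ℕ)
    (hfin : FiniteDimensional ℝ ↥(Submodule.span ℝ
      (Set.range fun u : List Γ => fun v : List Γ => f (u ++ v))))
    (hk : Module.finrank ℝ ↥(Submodule.span ℝ
      (Set.range fun u : List Γ => fun v : List Γ => f (u ++ v))) = k) :
    ∃ (α ω : Fin k → ℝ) (A : Γ → Matrix (Fin k) (Fin k) ℝ),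
      ∀ x : List Γ, f x = α ⬝ᵥ ((x.map A).prod *ᵥ ω) := by
  set V := Submodule.span ℝ
      (Set.range fun u : List Γ => fun v : List Γ => f (u ++ v)) with hV
  let b : Module.Basis (Fin k) ℝ V := Module.finBasisOfFinrankEq ℝ V hk
  -- the span is stable under left shifts
  have hshift : ∀ (σ : Γ) (g : List Γ → ℝ), g ∈ V → (fun v => g (σ :: v)) ∈ V := by
    intro σ g hg
    have hle : V ≤ V.comap (LinearMap.funLeft ℝ ℝ (fun v : List Γ => σ :: v)) := by
      rw [hV, Submodule.span_le]
      rintro _ ⟨u, rfl⟩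
      apply Submodule.subset_span
      refine ⟨u ++ [σ], ?_⟩
      funext v
      simp [LinearMap.funLeft_apply]
    exact hle hg
  have hf : f ∈ V := Submodule.subset_span ⟨[], by simp⟩
  have hexp : ∀ (g : V) (v : List Γ),
      (g : List Γ → ℝ) v = ∑ j, b.repr g j * (b j : List Γ → ℝ) v := by
    intro g v
    have h := congrArg (fun h : V => (h : List Γ → ℝ) v) (b.sum_repr g)
    refine h.symm.trans ?_
    simp only [Submodule.coe_sum, Finset.sum_apply, Submodule.coe_smul, Pi.smul_apply, smul_eq_mul]
  let A : Γ → Matrix (Fin k) (Fin k) ℝ := fun σ => Matrix.of fun i j =>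
    b.repr ⟨fun v => (b i : List Γ → ℝ) (σ :: v), hshift σ _ (b i).2⟩ j
  let ω : Fin k → ℝ := fun i => (b i : List Γ → ℝ) []
  have key : ∀ (x : List Γ) (i : Fin k),
      (b i : List Γ → ℝ) x = ((x.map A).prod *ᵥ ω) i := by
    intro x
    induction x with
    | nil => intro i; simp [ω]
    | cons σ x ih =>
      intro i
      rw [List.map_cons, List.prod_cons, ← Matrix.mulVec_mulVec]
      have h := hexp ⟨fun v => (b i : List Γ → ℝ) (σ :: v), hshift σ _ (b i).2⟩ x
      refine h.trans ?_
      simp only [ih]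
      rfl
  refine ⟨fun j => b.repr ⟨f, hf⟩ j, ω, A, fun x => ?_⟩
  refine (hexp ⟨f, hf⟩ x).trans ?_
  simp only [key]
  rfl
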